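/- For any x ∈ S_n, the interval [e, x] in the absolute order on S_n is isomorphic, as a poset, to the direct product over the cycles y in the cycle decomposition of x of the intervals [e, y]. -/

import Mathlib

/-- The reflection length of a permutation `w`: the smallest number of
transpositions whose product is `w`. -/
noncomputable def reflLen {n : ℕ} (w : Equiv.Perm (Fin n)) : ℕ :=
  sInf {k | ∃ l : List (Equiv.Perm (Fin n)), l.length = k ∧
    (∀ t ∈ l, t.IsSwap) ∧ l.prod = w}

/-- The absolute order on `S_n`: `u ⪯ v` iff `ℓ_T u + ℓ_T (u⁻¹ v) = ℓ_T v`. -/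
def AbsLe {n : ℕ} (u v : Equiv.Perm (Fin n)) : Prop :=
  reflLen u + reflLen (u⁻¹ * v) = reflLen v

/-- The space of rational functions on `Fin n` that are invariant under `w`. -/
def invariantFunctions {n : ℕ} (w : Equiv.Perm (Fin n)) : Submodule ℚ (Fin n → ℚ) where
  carrier := {f | ∀ i, f (w i) = f i}
  add_mem' hf hg i := congrArg₂ (· + ·) (hf i) (hg i)
  zero_mem' _ := rfl
  smul_mem' c _ hf i := congrArg (c • ·) (hf i)

theorem mem_invariantFunctions {n : ℕ} {w : Equiv.Perm (Fin n)} {f : Fin n → ℚ} :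
    f ∈ invariantFunctions w ↔ ∀ i, f (w i) = f i :=
  Iff.rfl

theorem inf_invariantFunctions_le_mul {n : ℕ} (u v : Equiv.Perm (Fin n)) :
    invariantFunctions u ⊓ invariantFunctions v ≤ invariantFunctions (u * v) :=
  fun _ hf i => (hf.1 (v i)).trans (hf.2 i)

theorem finrank_add_finrank_le_inf {n : ℕ} (p q : Submodule ℚ (Fin n → ℚ)) :
    Module.finrank ℚ p + Module.finrank ℚ q ≤ n + Module.finrank ℚ ↥(p ⊓ q) := by
  have h := Submodule.finrank_sup_add_finrank_inf_eq p q
  have h' := Submodule.finrank_le (p ⊔ q)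
  simp only [Module.finrank_fintype_fun_eq_card, Fintype.card_fin] at h'
  omega

theorem finrank_invariantFunctions_swap {n : ℕ} {t : Equiv.Perm (Fin n)} (ht : t.IsSwap) :
    n ≤ Module.finrank ℚ (invariantFunctions t) + 1 := by
  obtain ⟨a, b, -, rfl⟩ := ht
  let φ : (Fin n → ℚ) →ₗ[ℚ] ℚ := LinearMap.proj (R := ℚ) (φ := fun _ => ℚ) a -
    LinearMap.proj (R := ℚ) (φ := fun _ => ℚ) b
  have hker : LinearMap.ker φ ≤ invariantFunctions (Equiv.swap a b) := by
    intro f hf i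
    have hab : f a = f b := sub_eq_zero.mp hf
    rw [Equiv.swap_apply_def]
    split_ifs with h₁ h₂
    · rw [h₁, hab]
    · rw [h₂, hab]
    · rfl
  have h := LinearMap.finrank_range_add_finrank_ker φ
  have hrange := Submodule.finrank_le (LinearMap.range φ)
  have hle := Submodule.finrank_mono hker
  simp only [Module.finrank_fintype_fun_eq_card, Fintype.card_fin, Module.finrank_self] at h hrange
  omega

theorem le_finrank_invariantFunctions_prod {n : ℕ} (l : List (Equiv.Perm (Fin n)))
    (hl : ∀ t ∈ l, t.IsSwap) :
    n ≤ Module.finrank ℚ (invariantFunctions l.prod) + l.length := by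
  induction l with
  | nil =>
    have h : invariantFunctions (1 : Equiv.Perm (Fin n)) = ⊤ := by
      ext f
      simp [mem_invariantFunctions]
    rw [List.prod_nil, h, finrank_top]
    simp
  | cons t l ih =>
    have ht := finrank_invariantFunctions_swap (hl t (by simp))
    have hprod := ih fun s hs => hl s (by simp [hs])
    have hinf := finrank_add_finrank_le_inf (invariantFunctions t) (invariantFunctions l.prod)
    have hle := Submodule.finrank_mono (inf_invariantFunctions_le_mul t l.prod)
    rw [List.prod_cons, List.length_cons]
    omega

theorem invariantFunctions_lt_swap_mul {n : ℕ} {w : Equiv.Perm (Fin n)} {a : Fin n}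
    (ha : w a ≠ a) :
    invariantFunctions w < invariantFunctions (Equiv.swap a (w a) * w) := by
  refine lt_of_le_of_ne (fun f hf i => ?_) fun heq => ?_
  · rw [Equiv.Perm.mul_apply, Equiv.swap_apply_def]
    split_ifs with h₁ h₂
    · rw [hf a, ← h₁, hf i]
    · rw [w.injective h₂]
    · exact hf i
  · have hsingle : Pi.single a 1 ∈ invariantFunctions (Equiv.swap a (w a) * w) := by
      intro i
      by_cases hi : i = a
      · simp [hi]
      · have : (Equiv.swap a (w a) * w) i ≠ a := fun h =>
          hi ((Equiv.swap a (w a) * w).injective (h.trans (by simp)))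
        rw [Pi.single_eq_of_ne this, Pi.single_eq_of_ne hi]
    rw [← heq] at hsingle
    have := hsingle a
    simp [ha] at this

theorem exists_swap_factorization {n : ℕ} (w : Equiv.Perm (Fin n)) :
    ∃ l : List (Equiv.Perm (Fin n)), (∀ t ∈ l, t.IsSwap) ∧ l.prod = w ∧
      l.length + Module.finrank ℚ (invariantFunctions w) ≤ n := by
  induction h : n - Module.finrank ℚ (invariantFunctions w) using Nat.strong_induction_on
    generalizing w with
  | _ k ih =>
    have hn (v : Equiv.Perm (Fin n)) : Module.finrank ℚ (invariantFunctions v) ≤ n := by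
      simpa using Submodule.finrank_le (invariantFunctions v)
    by_cases hw : ∀ a, w a = a
    · exact ⟨[], by simp, (Equiv.ext hw).symm, by simpa using hn w⟩
    · push Not at hw
      obtain ⟨a, ha⟩ := hw
      have hlt := Submodule.finrank_lt_finrank_of_lt (invariantFunctions_lt_swap_mul ha)
      have hn' := hn (Equiv.swap a (w a) * w)
      obtain ⟨l, hl, hprod, hlen⟩ := ih _ (by omega) (Equiv.swap a (w a) * w) rfl
      refine ⟨Equiv.swap a (w a) :: l, ?_, ?_, ?_⟩
      · rintro t ht
        rcases List.mem_cons.mp ht with rfl | ht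
        · exact ⟨a, w a, ha.symm, rfl⟩
        · exact hl t ht
      · rw [List.prod_cons, hprod, Equiv.swap_mul_self_mul]
      · rw [List.length_cons]
        omega

theorem reflLen_add_finrank {n : ℕ} (w : Equiv.Perm (Fin n)) :
    reflLen w + Module.finrank ℚ (invariantFunctions w) = n := by
  obtain ⟨l, hl, hprod, hlen⟩ := exists_swap_factorization w
  have hmem : l.length ∈ {k | ∃ l : List (Equiv.Perm (Fin n)), l.length = k ∧
    (∀ t ∈ l, t.IsSwap) ∧ l.prod = w} := ⟨l, rfl, hl, hprod⟩
  have hle : reflLen w ≤ l.length := Nat.sInf_le hmem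
  obtain ⟨l', hlen', hl', hprod'⟩ := Nat.sInf_mem ⟨_, hmem⟩
  have hge := le_finrank_invariantFunctions_prod l' hl'
  rw [hprod', hlen'] at hge
  change n ≤ _ + reflLen w at hge
  omega

theorem reflLen_mul_le {n : ℕ} (u v : Equiv.Perm (Fin n)) :
    reflLen (u * v) ≤ reflLen u + reflLen v := by
  have hu := reflLen_add_finrank u
  have hv := reflLen_add_finrank v
  have huv := reflLen_add_finrank (u * v)
  have hinf := finrank_add_finrank_le_inf (invariantFunctions u) (invariantFunctions v)
  have hle := Submodule.finrank_mono (inf_invariantFunctions_le_mul u v)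
  omega

theorem AbsLe.invariantFunctions_le {n : ℕ} {u v : Equiv.Perm (Fin n)} (h : AbsLe u v) :
    invariantFunctions v ≤ invariantFunctions u := by
  have hle := inf_invariantFunctions_le_mul u (u⁻¹ * v)
  rw [mul_inv_cancel_left] at hle
  have hinf := finrank_add_finrank_le_inf (invariantFunctions u) (invariantFunctions (u⁻¹ * v))
  have hu := reflLen_add_finrank u
  have hv := reflLen_add_finrank v
  have huv := reflLen_add_finrank (u⁻¹ * v)
  unfold AbsLe at h
  rw [← Submodule.eq_of_le_of_finrank_le hle (by omega)]
  exact inf_le_left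

theorem AbsLe.apply_eq_self {n : ℕ} {u v : Equiv.Perm (Fin n)} (h : AbsLe u v) {a : Fin n}
    (ha : v a = a) : u a = a := by
  have hmem : Pi.single a 1 ∈ invariantFunctions v := fun i => by
    by_cases hi : i = a
    · rw [hi, ha]
    · have : v i ≠ a := fun h' => hi (v.injective (h'.trans ha.symm))
      rw [Pi.single_eq_of_ne this, Pi.single_eq_of_ne hi]
  have := h.invariantFunctions_le hmem a
  by_contra hne
  simp [hne] at this

theorem AbsLe.apply_mem_support_iff {n : ℕ} {z x y : Equiv.Perm (Fin n)} (h : AbsLe z x)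
    (hy : y ∈ x.cycleFactorsFinset) (a : Fin n) : z a ∈ y.support ↔ a ∈ y.support := by
  have hmem : (fun i => if i ∈ y.support then (1 : ℚ) else 0) ∈ invariantFunctions x := fun i => by
    have : x i ∈ y.support ↔ i ∈ y.support :=
      Equiv.Perm.mem_cycleFactorsFinset_support hy i
    simp only [this]
  have := h.invariantFunctions_le hmem a
  by_cases h₁ : z a ∈ y.support <;> by_cases h₂ : a ∈ y.support <;> simp_all

theorem reflLen_mul_of_disjoint {n : ℕ} {u v : Equiv.Perm (Fin n)} (h : u.Disjoint v) :
    reflLen (u * v) = reflLen u + reflLen v := by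
  have hsup : invariantFunctions u ⊔ invariantFunctions v = ⊤ := by
    refine eq_top_iff.mpr fun f _ => Submodule.mem_sup.mpr
      ⟨fun i => if u i = i then f i else 0, fun i => ?_,
        fun i => if u i = i then 0 else f i, fun i => ?_, ?_⟩
    · by_cases hi : u i = i <;> simp [hi]
    · rcases h i with hi | hi
      · have : u (v i) = v i := by
          rw [← Equiv.Perm.mul_apply, h.commute.eq, Equiv.Perm.mul_apply, hi]
        simp [hi, this]
      · simp [hi]
    · ext i
      by_cases hi : u i = i <;> simp [hi]
  have hinf : invariantFunctions (u * v) ≤ invariantFunctions u ⊓ invariantFunctions v := by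
    intro f hf
    refine ⟨fun i => ?_, fun i => ?_⟩
    · rcases h i with hi | hi
      · rw [hi]
      · simpa [hi] using hf i
    · rcases h i with hi | hi
      · have := hf i
        rwa [h.commute.eq, Equiv.Perm.mul_apply, hi] at this
      · rw [hi]
  have hdim := Submodule.finrank_sup_add_finrank_inf_eq (invariantFunctions u)
    (invariantFunctions v)
  rw [hsup, finrank_top, Module.finrank_fintype_fun_eq_card, Fintype.card_fin] at hdim
  have hle := Submodule.finrank_mono hinf
  have hu := reflLen_add_finrank u
  have hv := reflLen_add_finrank v
  have huv := reflLen_add_finrank (u * v)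
  have := reflLen_mul_le u v
  omega

theorem reflLen_noncommProd {n : ℕ} {ι : Type*} (s : Finset ι) (g : ι → Equiv.Perm (Fin n))
    (hg : Pairwise fun i j => (g i).Disjoint (g j))
    (comm : (s : Set ι).Pairwise fun i j => Commute (g i) (g j)) :
    reflLen (s.noncommProd g comm) = ∑ i ∈ s, reflLen (g i) := by
  classical
  induction s using Finset.induction_on with
  | empty =>
    have : reflLen (1 : Equiv.Perm (Fin n)) = 0 := Nat.sInf_eq_zero.mpr (Or.inl ⟨[], by simp⟩)
    simpa using this
  | insert a s ha ih =>
    rw [Finset.noncommProd_insert_of_notMem s a g comm ha, Finset.sum_insert ha,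
      reflLen_mul_of_disjoint, ih]
    exact Equiv.Perm.disjoint_noncommProd_right _ fun i hi => hg fun h => ha (h ▸ hi)

/-- The subgroup of permutations that fix every fixed point of `y`. -/
abbrev supportedIn {n : ℕ} (y : Equiv.Perm (Fin n)) : Subgroup (Equiv.Perm (Fin n)) :=
  fixingSubgroup (Equiv.Perm (Fin n)) {a | y a = a}

theorem mem_supportedIn {n : ℕ} {y w : Equiv.Perm (Fin n)} :
    w ∈ supportedIn y ↔ ∀ a, y a = a → w a = a :=
  mem_fixingSubgroup_iff _

theorem disjoint_of_mem_supportedIn {n : ℕ} {y y' w w' : Equiv.Perm (Fin n)}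
    (h : y.Disjoint y') (hw : w ∈ supportedIn y) (hw' : w' ∈ supportedIn y') : w.Disjoint w' :=
  fun a => (h a).imp (mem_supportedIn.mp hw a) (mem_supportedIn.mp hw' a)

theorem apply_ne_of_mem_supportedIn {n : ℕ} {y w : Equiv.Perm (Fin n)} (hw : w ∈ supportedIn y)
    {a : Fin n} (ha : y a ≠ a) : y (w a) ≠ w a := fun h =>
  ha (by
    have := w.injective (mem_supportedIn.mp hw _ h)
    rwa [this] at h)

theorem disjoint_cycles {n : ℕ} (x : Equiv.Perm (Fin n)) :
    Pairwise fun y y' : x.cycleFactorsFinset =>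
      (y : Equiv.Perm (Fin n)).Disjoint (y' : Equiv.Perm (Fin n)) :=
  fun y y' h => x.cycleFactorsFinset_pairwise_disjoint y.2 y'.2 (Subtype.coe_ne_coe.mpr h)

theorem commute_of_mem_supportedIn_cycles {n : ℕ} (x : Equiv.Perm (Fin n)) :
    Pairwise fun y y' : x.cycleFactorsFinset => ∀ w w' : Equiv.Perm (Fin n),
      w ∈ supportedIn (y : Equiv.Perm (Fin n)) → w' ∈ supportedIn (y' : Equiv.Perm (Fin n)) →
        Commute w w' :=
  fun _ _ h _ _ hw hw' => (disjoint_of_mem_supportedIn (disjoint_cycles x h) hw hw').commute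

/-- The homomorphism multiplying together permutations supported in the cycles of `x`. -/
noncomputable def cycleProd {n : ℕ} (x : Equiv.Perm (Fin n)) :
    (∀ y : x.cycleFactorsFinset, supportedIn (y : Equiv.Perm (Fin n))) →* Equiv.Perm (Fin n) :=
  Subgroup.noncommPiCoprod (commute_of_mem_supportedIn_cycles x)

theorem pairwise_commute_of_supportedIn_cycles {n : ℕ} {x : Equiv.Perm (Fin n)}
    (g : ∀ y : x.cycleFactorsFinset, supportedIn (y : Equiv.Perm (Fin n)))
    (s : Set x.cycleFactorsFinset) :
    s.Pairwise (Function.onFun Commute fun y => (g y : Equiv.Perm (Fin n))) :=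
  fun _ _ _ _ h => commute_of_mem_supportedIn_cycles x h _ _ (g _).2 (g _).2

theorem cycleProd_eq_noncommProd {n : ℕ} (x : Equiv.Perm (Fin n))
    (g : ∀ y : x.cycleFactorsFinset, supportedIn (y : Equiv.Perm (Fin n))) :
    cycleProd x g = Finset.univ.noncommProd (fun y => (g y : Equiv.Perm (Fin n)))
      (pairwise_commute_of_supportedIn_cycles g _) :=
  Subgroup.noncommPiCoprod_apply _ _

theorem reflLen_cycleProd {n : ℕ} (x : Equiv.Perm (Fin n))
    (g : ∀ y : x.cycleFactorsFinset, supportedIn (y : Equiv.Perm (Fin n))) :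
    reflLen (cycleProd x g) = ∑ y, reflLen (g y : Equiv.Perm (Fin n)) := by
  rw [cycleProd_eq_noncommProd]
  exact reflLen_noncommProd _ _
    (fun y y' h => disjoint_of_mem_supportedIn (disjoint_cycles x h) (g y).2 (g y').2) _

theorem cycleProd_apply_of_fixed {n : ℕ} {x : Equiv.Perm (Fin n)} {a : Fin n} (ha : x a = a)
    (g : ∀ y : x.cycleFactorsFinset, supportedIn (y : Equiv.Perm (Fin n))) :
    cycleProd x g a = a := by
  rw [cycleProd_eq_noncommProd]
  refine Finset.noncommProd_induction _ _ _ (fun w : Equiv.Perm (Fin n) => w a = a)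
    (fun u v hu hv => by rw [Equiv.Perm.mul_apply, hv, hu]) rfl fun y _ => ?_
  refine mem_supportedIn.mp (g y).2 a ?_
  by_contra hne
  have := (Equiv.Perm.mem_cycleFactorsFinset_iff.mp y.2).2 a (Equiv.Perm.mem_support.mpr hne)
  exact hne (this.trans ha)

theorem cycleProd_apply_of_moved {n : ℕ} {x : Equiv.Perm (Fin n)} (y : x.cycleFactorsFinset)
    {a : Fin n} (ha : (y : Equiv.Perm (Fin n)) a ≠ a)
    (g : ∀ y : x.cycleFactorsFinset, supportedIn (y : Equiv.Perm (Fin n))) :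
    cycleProd x g a = (g y : Equiv.Perm (Fin n)) a := by
  classical
  rw [cycleProd_eq_noncommProd,
    ← Finset.noncommProd_erase_mul _ (Finset.mem_univ y) _ _
      (pairwise_commute_of_supportedIn_cycles g _), Equiv.Perm.mul_apply]
  have hb := apply_ne_of_mem_supportedIn (g y).2 ha
  generalize (g y : Equiv.Perm (Fin n)) a = b at hb
  refine Finset.noncommProd_induction _ _ _ (fun w : Equiv.Perm (Fin n) => w b = b)
    (fun u v hu hv => by rw [Equiv.Perm.mul_apply, hv, hu]) rfl fun y' hy' => ?_
  exact mem_supportedIn.mp (g y').2 b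
    ((disjoint_cycles x (Finset.ne_of_mem_erase hy') b).resolve_right hb)

theorem cycleProd_injective {n : ℕ} (x : Equiv.Perm (Fin n)) :
    Function.Injective (cycleProd x) := by
  intro g h hgh
  ext y a : 3
  by_cases ha : (y : Equiv.Perm (Fin n)) a = a
  · rw [mem_supportedIn.mp (g y).2 a ha, mem_supportedIn.mp (h y).2 a ha]
  · rw [← cycleProd_apply_of_moved y ha, ← cycleProd_apply_of_moved y ha, hgh]

theorem cycleProd_eq_of_forall {n : ℕ} {x z : Equiv.Perm (Fin n)}
    (g : ∀ y : x.cycleFactorsFinset, supportedIn (y : Equiv.Perm (Fin n)))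
    (hfix : ∀ a, x a = a → z a = a)
    (hmove : ∀ (y : x.cycleFactorsFinset) (a), (y : Equiv.Perm (Fin n)) a ≠ a →
      (g y : Equiv.Perm (Fin n)) a = z a) :
    cycleProd x g = z := by
  ext1 a
  by_cases ha : x a = a
  · rw [cycleProd_apply_of_fixed ha, hfix a ha]
  · have hmem := Equiv.Perm.cycleOf_mem_cycleFactorsFinset_iff.mpr (Equiv.Perm.mem_support.mpr ha)
    have hne : x.cycleOf a a ≠ a := by rwa [Equiv.Perm.cycleOf_apply_self]
    rw [cycleProd_apply_of_moved ⟨_, hmem⟩ hne, hmove ⟨_, hmem⟩ a hne]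

theorem cycleProd_cycles {n : ℕ} (x : Equiv.Perm (Fin n)) :
    cycleProd x (fun y => ⟨y, mem_supportedIn.mpr fun _ => id⟩) = x :=
  cycleProd_eq_of_forall _ (fun _ => id) fun y a ha =>
    (Equiv.Perm.mem_cycleFactorsFinset_iff.mp y.2).2 a (Equiv.Perm.mem_support.mpr ha)

theorem absLe_cycleProd_iff {n : ℕ} (x : Equiv.Perm (Fin n))
    (g h : ∀ y : x.cycleFactorsFinset, supportedIn (y : Equiv.Perm (Fin n))) :
    AbsLe (cycleProd x g) (cycleProd x h) ↔
      ∀ y, AbsLe (g y : Equiv.Perm (Fin n)) (h y : Equiv.Perm (Fin n)) := by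
  unfold AbsLe
  rw [← map_inv, ← map_mul]
  simp only [reflLen_cycleProd, ← Finset.sum_add_distrib]
  rw [eq_comm, Finset.sum_eq_sum_iff_of_le]
  · simp [eq_comm]
  · intro y _
    simpa using reflLen_mul_le (g y : Equiv.Perm (Fin n)) ((g y)⁻¹ * h y : Equiv.Perm (Fin n))

theorem AbsLe.exists_cycleProd_eq {n : ℕ} {z x : Equiv.Perm (Fin n)} (h : AbsLe z x) :
    ∃ g, cycleProd x g = z := by
  have hmem (y : x.cycleFactorsFinset) :=
    h.apply_mem_support_iff y.2
  refine ⟨fun y => ⟨Equiv.Perm.ofSubtype (z.subtypePerm (hmem y)), ?_⟩,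
    cycleProd_eq_of_forall _ (fun a => h.apply_eq_self) fun y a ha => ?_⟩
  · exact mem_supportedIn.mpr fun a ha =>
      Equiv.Perm.ofSubtype_apply_of_not_mem _ (by simpa using ha)
  · exact Equiv.Perm.ofSubtype_apply_of_mem _ (Equiv.Perm.mem_support.mpr ha)

/-- For any `x ∈ S_n`, the interval `[e, x]` in the absolute order is
isomorphic, as a poset, to the direct product, over the cycles `y` of the cycle
decomposition of `x`, of the intervals `[e, y]`. -/
theorem interval_iso_prod_cycles {n : ℕ} (x : Equiv.Perm (Fin n)) :
    ∃ f : {z : Equiv.Perm (Fin n) // AbsLe z x} ≃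
        (∀ y : x.cycleFactorsFinset, {z : Equiv.Perm (Fin n) // AbsLe z (y : Equiv.Perm (Fin n))}),
      ∀ a b : {z : Equiv.Perm (Fin n) // AbsLe z x},
        (AbsLe a.1 b.1 ↔ ∀ y, AbsLe (f a y).1 (f b y).1) := by
  let lift (g : ∀ y : x.cycleFactorsFinset,
      {z : Equiv.Perm (Fin n) // AbsLe z (y : Equiv.Perm (Fin n))}) :
      ∀ y : x.cycleFactorsFinset, supportedIn (y : Equiv.Perm (Fin n)) :=
    fun y => ⟨(g y).1, mem_supportedIn.mpr fun _ => (g y).2.apply_eq_self⟩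
  have hlift g : AbsLe (cycleProd x (lift g)) x := by
    conv_rhs => rw [← cycleProd_cycles x]
    exact (absLe_cycleProd_iff x _ _).mpr fun y => (g y).2
  let e := Equiv.ofBijective (fun g => (⟨cycleProd x (lift g), hlift g⟩ :
      {z : Equiv.Perm (Fin n) // AbsLe z x})) ⟨fun g h hgh => ?_, fun z => ?_⟩
  · refine ⟨e.symm, fun a b => ?_⟩
    have key := absLe_cycleProd_iff x (lift (e.symm a)) (lift (e.symm b))
    have ha : cycleProd x (lift (e.symm a)) = a := congrArg Subtype.val (e.apply_symm_apply a)
    have hb : cycleProd x (lift (e.symm b)) = b := congrArg Subtype.val (e.apply_symm_apply b)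
    rwa [ha, hb] at key
  · have heq := cycleProd_injective x (congrArg Subtype.val hgh)
    funext y
    exact Subtype.ext (congrArg (fun w => w.1) (congrFun heq y))
  · obtain ⟨g, hg⟩ := z.2.exists_cycleProd_eq
    have hle := z.2
    rw [← hg] at hle
    conv_rhs at hle => rw [← cycleProd_cycles x]
    exact ⟨fun y => ⟨g y, (absLe_cycleProd_iff x _ _).mp hle y⟩, Subtype.ext hg⟩
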